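/- Fix positive reals a, b and λ, μ ∈ [0, 1]. For x > 0 let y(x) = arcosh((cosh a + cosh b·cosh x)/(sinh b·sinh x)), and define S(x) = arcosh(cosh(μ·x) · cosh(λ·b) · cosh(y(x)) − sinh(μ·x) · sinh(λ·b)). Then for every x > 0, S is differentiable at x and |S'(x)| < 3·coth x. -/

import Mathlib

noncomputable def arcosh (x : ℝ) : ℝ := Real.log (x + Real.sqrt (x ^ 2 - 1))

noncomputable def coth (x : ℝ) : ℝ := Real.cosh x / Real.sinh x

lemma aux_G (B C T Y : ℝ) (hB : 1 < B) (hC : 1 < C) (hT : B * T = 1) (hY : B * C < Y) :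
    (C * Y - B) ^ 2 ≤ 4 * (C ^ 2 * Y ^ 2 - C ^ 2 - 2 * (C * Y) * T + 1 + C ^ 2 * T ^ 2) := by
  have hT0 : 0 < T := by
    by_contra h
    push Not at h
    nlinarith
  have hT1 : T < 1 := by nlinarith
  obtain ⟨d, hd⟩ : ∃ d, d = C * Y - B * C ^ 2 := ⟨_, rfl⟩
  have hd0 : 0 ≤ d := by rw [hd]; nlinarith
  have hW : C * Y = B * C ^ 2 + d := by rw [hd]; ring
  have hk : 1 < C ^ 2 := by nlinarith
  have hm : 1 < B ^ 2 := by nlinarith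
  have hn1 : T ^ 2 < 1 := by nlinarith
  have hmn : B ^ 2 * T ^ 2 = 1 := by rw [← mul_pow, hT]; norm_num
  have e1 : C ^ 2 * Y ^ 2 = (B * C ^ 2 + d) ^ 2 := by rw [← hW]; ring
  rw [e1, hW]
  generalize C ^ 2 = k at *
  have h1 : 1 - T ^ 2 ≤ B ^ 2 - 1 := by
    have : 1 - T ^ 2 = (B ^ 2 - 1) * T ^ 2 := by linear_combination -hmn
    rw [this]; nlinarith
  have h2 : 0 ≤ 3 * (k - 1) ^ 2 + (B ^ 2 - 1) * (3 * k ^ 2 + 2 * k - 1) - 4 * k * (1 - T ^ 2) := by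
    have h3 : k * (1 - T ^ 2) ≤ k * (B ^ 2 - 1) := mul_le_mul_of_nonneg_left h1 (by linarith)
    have h4 : 0 ≤ (B ^ 2 - 1) * (3 * k ^ 2 - 2 * k - 1) :=
      mul_nonneg (by linarith) (by nlinarith)
    nlinarith [sq_nonneg (k - 1)]
  have h5 : 0 ≤ d * (6 * (B * k) - 8 * T + 2 * B) := by
    apply mul_nonneg hd0
    nlinarith
  have : 4 * ((B * k + d) ^ 2 - k - 2 * (B * k + d) * T + 1 + k * T ^ 2) - (B * k + d - B) ^ 2
      = (3 * (k - 1) ^ 2 + (B ^ 2 - 1) * (3 * k ^ 2 + 2 * k - 1) - 4 * k * (1 - T ^ 2))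
        + d * (6 * (B * k) - 8 * T + 2 * B) + 3 * d ^ 2 := by
    linear_combination (-8 * k) * hT
  nlinarith [sq_nonneg d]

lemma aux_Q (B C Y s t : ℝ) (hB : 1 < B) (hC : 1 < C) (hY : B * C < Y)
    (hs : 0 ≤ s) (hsC : s * C ≤ 1) (ht : 0 ≤ t) (htB : t * B ≤ 1) :
    (C * Y - B) ^ 2 ≤ 4 * C ^ 2 * (Y ^ 2 - 1 - 2 * Y * s * t + s ^ 2 + t ^ 2) := by
  have hB0 : (0:ℝ) < B := by linarith
  have hC0 : (0:ℝ) < C := by linarith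
  obtain ⟨T, hT⟩ : ∃ T, B * T = 1 := ⟨B⁻¹, mul_inv_cancel₀ hB0.ne'⟩
  obtain ⟨S, hS⟩ : ∃ S, C * S = 1 := ⟨C⁻¹, mul_inv_cancel₀ hC0.ne'⟩
  have hT0 : 0 < T := by
    by_contra h
    push Not at h
    nlinarith
  have hS0 : 0 < S := by
    by_contra h
    push Not at h
    nlinarith
  have hT1 : T < 1 := by nlinarith
  have hS1 : S < 1 := by nlinarith
  have key := aux_G B C T Y hB hC hT hY
  obtain ⟨α, hα⟩ : ∃ α, α = s * C := ⟨_, rfl⟩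
  obtain ⟨β, hβ⟩ : ∃ β, β = t * B := ⟨_, rfl⟩
  have es : s = α * S := by rw [hα]; linear_combination (-s) * hS
  have et : t = β * T := by rw [hβ]; linear_combination (-t) * hT
  have hα0 : 0 ≤ α := by rw [hα]; positivity
  have hβ0 : 0 ≤ β := by rw [hβ]; positivity
  rw [← hα] at hsC
  rw [← hβ] at htB
  have hYST : 1 ≤ Y * S * T := by
    have : B * C * (S * T) < Y * (S * T) := mul_lt_mul_of_pos_right hY (by positivity)
    have e : B * C * (S * T) = 1 := by linear_combination (C * S) * hT + hS
    nlinarith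
  have h1 : (1 - α * β) ≤ Y * S * T * (1 - α * β) :=
    le_mul_of_one_le_left (by nlinarith) hYST
  have h2 : S ^ 2 * (1 - α ^ 2) ≤ 1 - α ^ 2 :=
    mul_le_of_le_one_left (by nlinarith) (by nlinarith)
  have h3 : T ^ 2 * (1 - β ^ 2) ≤ 1 - β ^ 2 :=
    mul_le_of_le_one_left (by nlinarith) (by nlinarith)
  have h4 : Y ^ 2 - 1 - 2 * Y * S * T + S ^ 2 + T ^ 2 ≤ Y ^ 2 - 1 - 2 * Y * s * t + s ^ 2 + t ^ 2 := by
    rw [es, et]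
    nlinarith [sq_nonneg (α - β)]
  have h5 := mul_le_mul_of_nonneg_left h4 (by positivity : 0 ≤ 4 * C ^ 2)
  have e : 4 * C ^ 2 * (Y ^ 2 - 1 - 2 * Y * S * T + S ^ 2 + T ^ 2) =
      4 * (C ^ 2 * Y ^ 2 - C ^ 2 - 2 * (C * Y) * T + 1 + C ^ 2 * T ^ 2) := by
    linear_combination (4 * (C * S + 1) - 8 * C * Y * T) * hS
  linarith

lemma aux_tanh (m x : ℝ) (hm : m ∈ Set.Icc (0 : ℝ) 1) (hx : 0 < x) :
    0 ≤ Real.sinh (m * x) / Real.cosh (m * x) ∧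
    Real.sinh (m * x) / Real.cosh (m * x) * (Real.cosh x / Real.sinh x) ≤ 1 := by
  have hp : 0 ≤ m * x := mul_nonneg hm.1 hx.le
  have h1 := Real.cosh_pos (m * x)
  have h2 : 0 < Real.sinh x := Real.sinh_pos_iff.2 hx
  refine ⟨div_nonneg (Real.sinh_nonneg_iff.2 hp) h1.le, ?_⟩
  rw [div_mul_div_comm, div_le_one (by positivity)]
  have : 0 ≤ Real.sinh (x - m * x) := Real.sinh_nonneg_iff.2 (by nlinarith [hm.2])
  rw [Real.sinh_sub] at this
  linarith

lemma aux_coth (x : ℝ) (hx : 0 < x) : 1 < Real.cosh x / Real.sinh x := by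
  rw [one_lt_div (Real.sinh_pos_iff.2 hx)]
  exact Real.sinh_lt_cosh x

lemma aux_Y (a b x : ℝ) (hb : 0 < b) (hx : 0 < x) :
    Real.cosh b / Real.sinh b * (Real.cosh x / Real.sinh x) <
      (Real.cosh a + Real.cosh b * Real.cosh x) / (Real.sinh b * Real.sinh x) := by
  have h2 : 0 < Real.sinh x := Real.sinh_pos_iff.2 hx
  have h3 : 0 < Real.sinh b := Real.sinh_pos_iff.2 hb
  rw [div_mul_div_comm]
  have := Real.cosh_pos a
  gcongr
  linarith

lemma aux_one (a b x : ℝ) (hb : 0 < b) (hx : 0 < x) :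
    1 < (Real.cosh a + Real.cosh b * Real.cosh x) / (Real.sinh b * Real.sinh x) := by
  have h1 := aux_coth x hx
  have h2 := aux_coth b hb
  have h3 := aux_Y a b x hb hx
  nlinarith

set_option maxHeartbeats 1000000

theorem stmt_17 (a b lam mu : ℝ) (ha : 0 < a) (hb : 0 < b)
    (hlam : lam ∈ Set.Icc (0 : ℝ) 1) (hmu : mu ∈ Set.Icc (0 : ℝ) 1) :
    ∀ x > (0 : ℝ),
      DifferentiableAt ℝ
        (fun x : ℝ =>
          arcosh
            (Real.cosh (mu * x) * Real.cosh (lam * b) *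
              Real.cosh (arcosh ((Real.cosh a + Real.cosh b * Real.cosh x) /
                (Real.sinh b * Real.sinh x))) -
            Real.sinh (mu * x) * Real.sinh (lam * b))) x ∧
      |deriv (fun x : ℝ =>
          arcosh
            (Real.cosh (mu * x) * Real.cosh (lam * b) *
              Real.cosh (arcosh ((Real.cosh a + Real.cosh b * Real.cosh x) /
                (Real.sinh b * Real.sinh x))) -
            Real.sinh (mu * x) * Real.sinh (lam * b))) x| < 3 * coth x := by
  intro x hx
  have hsx : 0 < Real.sinh x := Real.sinh_pos_iff.2 hx
  have hsb : 0 < Real.sinh b := Real.sinh_pos_iff.2 hb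
  obtain ⟨Y, hYdef⟩ : ∃ Y, Y = (Real.cosh a + Real.cosh b * Real.cosh x) /
                (Real.sinh b * Real.sinh x) := ⟨_, rfl⟩
  have hC := aux_coth x hx
  have hB := aux_coth b hb
  have hY := aux_Y a b x hb hx
  have hY1 := aux_one a b x hb hx
  rw [← hYdef] at hY hY1
  obtain ⟨C, hCdef⟩ : ∃ C, C = Real.cosh x / Real.sinh x := ⟨_, rfl⟩
  obtain ⟨B, hBdef⟩ : ∃ B, B = Real.cosh b / Real.sinh b := ⟨_, rfl⟩
  obtain ⟨hs0, hsC⟩ := aux_tanh mu x hmu hx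
  obtain ⟨ht0, htB⟩ := aux_tanh lam b hlam hb
  have hcp := Real.cosh_pos (mu * x)
  have hcq := Real.cosh_pos (lam * b)
  have hp2 := Real.cosh_sq (mu * x)
  have hq2 := Real.cosh_sq (lam * b)
  obtain ⟨s, hs⟩ : ∃ s, s = Real.sinh (mu * x) / Real.cosh (mu * x) := ⟨_, rfl⟩
  obtain ⟨t, ht⟩ : ∃ t, t = Real.sinh (lam * b) / Real.cosh (lam * b) := ⟨_, rfl⟩
  rw [← hs] at hs0 hsC
  rw [← ht] at ht0 htB
  rw [← hCdef] at hsC hC hY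
  rw [← hBdef] at htB hB hY
  have hs' : Real.sinh (mu * x) = s * Real.cosh (mu * x) := by rw [hs]; field_simp
  have ht' : Real.sinh (lam * b) = t * Real.cosh (lam * b) := by rw [ht]; field_simp
  have hQ := aux_Q B C Y s t hB hC hY hs0 hsC ht0 htB
  obtain ⟨F, hF⟩ : ∃ F, F = Real.cosh (mu * x) * Real.cosh (lam * b) * Y -
      Real.sinh (mu * x) * Real.sinh (lam * b) := ⟨_, rfl⟩
  obtain ⟨Q, hQdef⟩ : ∃ Q, Q = Y ^ 2 - 1 - 2 * Y * s * t + s ^ 2 + t ^ 2 := ⟨_, rfl⟩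
  rw [← hQdef] at hQ
  have hFQ : F ^ 2 - 1 = (Real.cosh (mu * x) * Real.cosh (lam * b)) ^ 2 * Q := by
    rw [hF, hQdef]
    rw [hs'] at hp2 ⊢
    rw [ht'] at hq2 ⊢
    have e1 : Real.cosh (mu * x) ^ 2 * (1 - s ^ 2) = 1 := by linear_combination hp2
    have e2 : Real.cosh (lam * b) ^ 2 * (1 - t ^ 2) = 1 := by linear_combination hq2
    linear_combination (Real.cosh (lam * b) ^ 2 * (1 - t ^ 2)) * e1 + e2
  have hCYB : 0 < C * Y - B := by
    clear * - hB hC hY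
    have h1 : B < B * C := lt_mul_of_one_lt_right (by linarith) hC
    have h2 : Y < C * Y := lt_mul_of_one_lt_left (by linarith) hC
    linarith
  have hQpos : 0 < Q := by
    have h1 : 0 < (C * Y - B) ^ 2 := by positivity
    have h2 : 0 < 4 * C ^ 2 * Q := by linarith
    exact pos_of_mul_pos_right h2 (by positivity)
  have hF0 : 0 < F := by
    have : F = Real.cosh (mu * x) * Real.cosh (lam * b) * (Y - s * t) := by
      rw [hF, hs', ht']; ring
    rw [this]
    have h1 : s ≤ 1 := (le_mul_of_one_le_right hs0 hC.le).trans hsC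
    have h2 : t ≤ 1 := (le_mul_of_one_le_right ht0 hB.le).trans htB
    have h3 : 0 < Y - s * t := by linarith [mul_le_one₀ h1 ht0 h2]
    positivity
  have hF1 : 1 < F := by
    have : 0 < F ^ 2 - 1 := by rw [hFQ]; positivity
    clear * - this hF0
    nlinarith
  have hYd : HasDerivAt (fun x : ℝ => (Real.cosh a + Real.cosh b * Real.cosh x) /
                (Real.sinh b * Real.sinh x)) (B - C * Y) x := by
    have h := (((Real.hasDerivAt_cosh x).const_mul (Real.cosh b)).const_add (Real.cosh a)).div
      ((Real.hasDerivAt_sinh x).const_mul (Real.sinh b)) (by positivity)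
    refine HasDerivAt.congr_deriv h ?_
    rw [hBdef, hCdef, hYdef]
    field_simp
  have hmx : HasDerivAt (fun x : ℝ => mu * x) mu x := by
    simpa using (hasDerivAt_id x).const_mul mu
  have hFd : HasDerivAt (fun x : ℝ => Real.cosh (mu * x) * Real.cosh (lam * b) *
              ((Real.cosh a + Real.cosh b * Real.cosh x) /
                (Real.sinh b * Real.sinh x)) -
            Real.sinh (mu * x) * Real.sinh (lam * b))
      (mu * (Real.sinh (mu * x) * Real.cosh (lam * b) * Y
          - Real.cosh (mu * x) * Real.sinh (lam * b))
        - Real.cosh (mu * x) * Real.cosh (lam * b) * (C * Y - B)) x := by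
    have h := ((hmx.cosh.mul_const (Real.cosh (lam * b))).mul hYd).sub
      (hmx.sinh.mul_const (Real.sinh (lam * b)))
    refine HasDerivAt.congr_deriv h ?_
    rw [← hYdef]
    ring
  obtain ⟨A, hA⟩ : ∃ A, A = Real.sinh (mu * x) * Real.cosh (lam * b) * Y
          - Real.cosh (mu * x) * Real.sinh (lam * b) := ⟨_, rfl⟩
  rw [← hA] at hFd
  have hFx : Real.cosh (mu * x) * Real.cosh (lam * b) *
              ((Real.cosh a + Real.cosh b * Real.cosh x) /
                (Real.sinh b * Real.sinh x)) -
            Real.sinh (mu * x) * Real.sinh (lam * b) = F := by rw [hF, hYdef]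
  have hSd0 := HasDerivAt.comp x (h₂ := Real.arcosh) (by
    rw [hFx]; exact Real.hasDerivAt_arcosh hF1) hFd
  have hSd := hSd0.congr_of_eventuallyEq (f₁ := fun x : ℝ =>
          arcosh
            (Real.cosh (mu * x) * Real.cosh (lam * b) *
              Real.cosh (arcosh ((Real.cosh a + Real.cosh b * Real.cosh x) /
                (Real.sinh b * Real.sinh x))) -
            Real.sinh (mu * x) * Real.sinh (lam * b))) (by
    filter_upwards [lt_mem_nhds hx] with z hz
    have : Real.cosh (arcosh ((Real.cosh a + Real.cosh b * Real.cosh z) /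
                (Real.sinh b * Real.sinh z))) = _ := Real.cosh_arcosh (aux_one a b z hb hz).le
    rw [this]
    rfl)
  refine ⟨hSd.differentiableAt, ?_⟩
  rw [hSd.deriv]
  have hR : 0 < √(F ^ 2 - 1) := Real.sqrt_pos.2 (by clear * - hF1; nlinarith)
  have hR2 : √(F ^ 2 - 1) ^ 2 = F ^ 2 - 1 := Real.sq_sqrt (by clear * - hF1; nlinarith)
  obtain ⟨R, hRdef⟩ : ∃ R, R = √(F ^ 2 - 1) := ⟨_, rfl⟩
  rw [← hRdef] at hR hR2 ⊢
  have hAR : |A| ≤ R := by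
    apply abs_le_of_sq_le_sq _ hR.le
    rw [hR2]
    have : F ^ 2 - A ^ 2 = Real.cosh (lam * b) ^ 2 * Y ^ 2 - Real.sinh (lam * b) ^ 2 := by
      rw [hF, hA]
      linear_combination (Real.cosh (lam * b) ^ 2 * Y ^ 2 - Real.sinh (lam * b) ^ 2) * hp2
    have h2 : Real.cosh (lam * b) ^ 2 * 1 ≤ Real.cosh (lam * b) ^ 2 * Y ^ 2 := by
      apply mul_le_mul_of_nonneg_left _ (by positivity)
      clear * - hY1
      nlinarith
    linarith
  have hDR : Real.cosh (mu * x) * Real.cosh (lam * b) * (C * Y - B) ≤ 2 * C * R := by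
    refine (fun h1 h2 => le_of_abs_le (abs_le_of_sq_le_sq h1 h2)) ?_ ?_
    · rw [mul_pow (2 * C) R, hR2, hFQ]
      have := mul_le_mul_of_nonneg_left hQ (sq_nonneg (Real.cosh (mu * x) * Real.cosh (lam * b)))
      linarith
    · positivity
  have hD0 : 0 < Real.cosh (mu * x) * Real.cosh (lam * b) * (C * Y - B) := by positivity
  rw [abs_mul, abs_of_pos (inv_pos.2 hR), inv_mul_lt_iff₀ hR]
  have hcoth : coth x = C := by rw [hCdef]; rfl
  rw [hcoth]
  obtain ⟨hA1, hA2⟩ := abs_le.1 hAR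
  have hCR : R < C * R := lt_mul_of_one_lt_left hR hC
  have hm0 := hmu.1
  have hm1 := hmu.2
  have k1 : mu * A ≤ R := by clear * - hA2 hm0 hm1 hR; nlinarith
  have k2 : -R ≤ mu * A := by clear * - hA1 hm0 hm1 hR; nlinarith
  rw [abs_lt]
  constructor <;> linarith
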